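/- Let N ≥ 1 and let p, r be real numbers with 1 < p < r. Let ξ : ℝ^N → ℝ be continuous with ξ(x) > 0 for every x and ξ ∈ L^{r/(r−p)}(ℝ^N). Let F be a finite-dimensional subspace of L^r(ℝ^N). Then there exists ε > 0 such that for every u ∈ F with u ≠ 0, the Lebesgue measure of the set {x ∈ ℝ^N : ξ(x)·|u(x)|^p ≥ ε·‖u‖_{L^r}^p} is at least ε. -/

import Mathlib

open MeasureTheory Filter Topology ENNReal

/-- Local version: near a nonzero element the bound holds uniformly. -/
theorem local_bound {α : Type*} [MeasurableSpace α] {μ : Measure α} {q : ℝ≥0∞} [Fact (1 ≤ q)]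
    {p : ℝ} (hp : 0 < p) {ξ : α → ℝ} (hξ : ∀ x, 0 < ξ x) (u : Lp ℝ q μ) (hu : u ≠ 0) :
    ∃ ε : ℝ, 0 < ε ∧ ∀ᶠ v in 𝓝 u, ENNReal.ofReal ε ≤ μ {x | ε ≤ ξ x * |v x| ^ p} := by
  obtain ⟨n, hn⟩ : ∃ n : ℕ, μ {x | 1 / ((n : ℝ) + 1) ≤ ξ x ∧ 1 / ((n : ℝ) + 1) ≤ |u x|} ≠ 0 := by
    by_contra! h
    apply hu
    rw [Lp.eq_zero_iff_ae_eq_zero]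
    have h2 := measure_iUnion_null h
    refine measure_mono_null ?_ h2
    intro x hx
    have hx0 : 0 < |u x| := abs_pos.mpr hx
    obtain ⟨n, hn⟩ := exists_nat_one_div_lt (lt_min (hξ x) hx0)
    exact Set.mem_iUnion.mpr ⟨n, (hn.trans_le (min_le_left _ _)).le,
      (hn.trans_le (min_le_right _ _)).le⟩
  set δ : ℝ := 1 / ((n : ℝ) + 1) with hδ
  have hδ0 : 0 < δ := by positivity
  set A := {x | δ ≤ ξ x ∧ δ ≤ |u x|} with hA
  have hm0 : μ A / 2 ≠ 0 := (ENNReal.half_pos hn).ne'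
  obtain ⟨η, hη0, hη⟩ : ∃ η : ℝ, 0 < η ∧ ENNReal.ofReal η ≤ min (μ A / 2) 1 := by
    have hne : min (μ A / 2) 1 ≠ ⊤ := (min_lt_of_right_lt one_lt_top).ne
    have hpos : 0 < min (μ A / 2) 1 := lt_min (pos_iff_ne_zero.mpr hm0) one_pos
    exact ⟨(min (μ A / 2) 1).toReal, ENNReal.toReal_pos hpos.ne' hne,
      (ENNReal.ofReal_toReal hne).le⟩
  have hηA : ENNReal.ofReal η + ENNReal.ofReal η ≤ μ A := by
    calc _ ≤ μ A / 2 + μ A / 2 :=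
          add_le_add (hη.trans (min_le_left _ _)) (hη.trans (min_le_left _ _))
      _ = μ A := ENNReal.add_halves _
  have hη0' : 0 < ENNReal.ofReal η := ENNReal.ofReal_pos.mpr hη0
  have hT := tendstoInMeasure_of_tendsto_Lp (f := fun v : Lp ℝ q μ => v) (g := u) (l := 𝓝 u)
    tendsto_id
  rw [tendstoInMeasure_iff_norm] at hT
  have hev := (hT (δ / 2) (by positivity)).eventually (gt_mem_nhds hη0')
  refine ⟨min η (δ * (δ / 2) ^ p), by positivity, ?_⟩
  filter_upwards [hev] with v hv
  set B := {x | δ / 2 ≤ ‖v x - u x‖} with hB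
  set C := {x | min η (δ * (δ / 2) ^ p) ≤ ξ x * |v x| ^ p} with hC
  have hsub : A ⊆ C ∪ B := by
    intro x hx
    by_cases hxB : x ∈ B
    · exact Or.inr hxB
    · left
      have h1 : |v x - u x| < δ / 2 := not_le.mp hxB
      have h2 : δ / 2 ≤ |v x| := by
        have := abs_sub_abs_le_abs_sub (u x) (v x)
        rw [abs_sub_comm] at this
        have := hx.2
        linarith
      change min η (δ * (δ / 2) ^ p) ≤ ξ x * |v x| ^ p
      refine (min_le_right _ _).trans ?_
      exact mul_le_mul hx.1 (Real.rpow_le_rpow (by positivity) h2 hp.le) (by positivity) (hξ x).le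
  refine (ENNReal.ofReal_le_ofReal (min_le_left _ _)).trans ?_
  have h3 : ENNReal.ofReal η + ENNReal.ofReal η ≤ μ C + ENNReal.ofReal η :=
    hηA.trans ((measure_mono hsub).trans ((measure_union_le _ _).trans
      (add_le_add le_rfl hv.le)))
  exact (ENNReal.add_le_add_iff_right ENNReal.ofReal_ne_top).mp h3


open MeasureTheory

/-- Let `N ≥ 1`, `1 < p < r`, `ξ : ℝ^N → ℝ` continuous, positive and
in `L^{r/(r−p)}(ℝ^N)`, and `F` a finite-dimensional subspace of `L^r(ℝ^N)`. Then
there is `ε > 0` such that for every `u ∈ F ∖ {0}` the Lebesgue measure of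
`{x : ξ(x)·|u(x)|^p ≥ ε·‖u‖_{L^r}^p}` is at least `ε`. -/
theorem stmt_11 (N : ℕ) (hN : 1 ≤ N) (p r : ℝ) (hp : 1 < p) (hpr : p < r)
    (ξ : EuclideanSpace ℝ (Fin N) → ℝ) (hξ_cont : Continuous ξ)
    (hξ_pos : ∀ x, 0 < ξ x)
    (hξ_int : ∫⁻ x, ENNReal.ofReal (ξ x ^ (r / (r - p))) < ⊤)
    (F : Submodule ℝ (Lp ℝ (ENNReal.ofReal r)
      (volume : Measure (EuclideanSpace ℝ (Fin N)))))
    (hF : FiniteDimensional ℝ F) :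
    ∃ ε : ℝ, 0 < ε ∧ ∀ u : F, u ≠ 0 →
      ENNReal.ofReal ε ≤ volume {x : EuclideanSpace ℝ (Fin N) |
        ε * ‖(u : Lp ℝ (ENNReal.ofReal r)
            (volume : Measure (EuclideanSpace ℝ (Fin N))))‖ ^ p ≤
          ξ x * |(u : Lp ℝ (ENNReal.ofReal r)
            (volume : Measure (EuclideanSpace ℝ (Fin N)))) x| ^ p} := by
  have hr1 : 1 ≤ ENNReal.ofReal r := by
    rw [← ENNReal.ofReal_one]
    exact ENNReal.ofReal_le_ofReal (by linarith)
  haveI : Fact (1 ≤ ENNReal.ofReal r) := ⟨hr1⟩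
  have hp0 : 0 < p := by linarith
  haveI : ProperSpace F := FiniteDimensional.proper ℝ F
  have hK : IsCompact (Metric.sphere (0 : F) 1) := isCompact_sphere _ _
  have key : ∃ ε : ℝ, 0 < ε ∧ ∀ v ∈ Metric.sphere (0 : F) 1, ENNReal.ofReal ε ≤
      volume {x | ε ≤ ξ x * |(v : Lp ℝ (ENNReal.ofReal r)
        (volume : Measure (EuclideanSpace ℝ (Fin N)))) x| ^ p} := by
    refine hK.induction_on (p := fun S : Set F => ∃ ε : ℝ, 0 < ε ∧ ∀ v ∈ S, ENNReal.ofReal ε ≤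
      volume {x | ε ≤ ξ x * |(v : Lp ℝ (ENNReal.ofReal r)
        (volume : Measure (EuclideanSpace ℝ (Fin N)))) x| ^ p}) ?_ ?_ ?_ ?_
    · exact ⟨1, one_pos, by simp⟩
    · rintro s t hst ⟨ε, h0, h⟩
      exact ⟨ε, h0, fun v hv => h v (hst hv)⟩
    · rintro s t ⟨ε, h0, h⟩ ⟨ε', h0', h'⟩
      refine ⟨min ε ε', lt_min h0 h0', ?_⟩
      rintro v (hv | hv)
      · exact (ENNReal.ofReal_le_ofReal (min_le_left _ _)).trans ((h v hv).trans
          (measure_mono fun x hx => le_trans (α := ℝ) (min_le_left _ _) hx))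
      · exact (ENNReal.ofReal_le_ofReal (min_le_right _ _)).trans ((h' v hv).trans
          (measure_mono fun x hx => le_trans (α := ℝ) (min_le_right _ _) hx))
    · intro u hu
      have hu0 : (u : Lp ℝ (ENNReal.ofReal r)
          (volume : Measure (EuclideanSpace ℝ (Fin N)))) ≠ 0 := by
        intro h
        have : u = 0 := Subtype.ext h
        subst this
        simp at hu
      obtain ⟨ε, h0, h⟩ := local_bound hp0 hξ_pos _ hu0
      have h2 := (continuous_subtype_val (p := fun v => v ∈ F)).continuousAt (x := u) |>.eventually h
      exact ⟨_, mem_nhdsWithin_of_mem_nhds h2, ε, h0, fun v hv => hv⟩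
  obtain ⟨ε, h0, h⟩ := key
  refine ⟨ε, h0, fun u hu => ?_⟩
  have hun : 0 < ‖u‖ := norm_pos_iff.mpr hu
  have hv : ‖u‖⁻¹ • u ∈ Metric.sphere (0 : F) 1 := by
    rw [mem_sphere_zero_iff_norm, norm_smul, norm_inv, norm_norm, inv_mul_cancel₀ hun.ne']
  refine (h _ hv).trans (measure_mono_ae ?_)
  have hc := Lp.coeFn_smul (‖u‖⁻¹) (u : Lp ℝ (ENNReal.ofReal r)
          (volume : Measure (EuclideanSpace ℝ (Fin N))))
  filter_upwards [hc] with x hx hle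
  change ε ≤ ξ x * |(‖u‖⁻¹ • (u : Lp ℝ (ENNReal.ofReal r)
          (volume : Measure (EuclideanSpace ℝ (Fin N)))) : Lp ℝ (ENNReal.ofReal r)
          (volume : Measure (EuclideanSpace ℝ (Fin N)))) x| ^ p at hle
  change ε * ‖u‖ ^ p ≤ _
  rw [hx, Pi.smul_apply, smul_eq_mul, abs_mul, abs_inv, abs_norm,
    Real.mul_rpow (by positivity) (by positivity), Real.inv_rpow hun.le] at hle
  have hpp : 0 < ‖u‖ ^ p := Real.rpow_pos_of_pos hun p
  calc ε * ‖u‖ ^ p ≤ _ := mul_le_mul_of_nonneg_right hle hpp.le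
    _ = _ := by field_simp
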